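/- Let f : ℂ → ℂ be an entire function that is not a polynomial, and suppose there exists b ∈ ℂ such that f′(z) ≠ b for all z ∈ ℂ (i.e., the derivative f′ omits the value b). Then the complex vector space { g : ℂ → ℂ entire : ∫_ℂ |g(z)|² (1 + |f′(z)|²)^{−1} dA(z) < ∞ } is infinite-dimensional over ℂ, where dA is Lebesgue measure on ℂ ≅ ℝ². -/

import Mathlib

open MeasureTheory

open Filter Topology Bornology Polynomial

/-- An entire function staying away from a value outside a disc has polynomial growth. -/
lemma exists_isBigO_pow_of_le_norm_sub {F : ℂ → ℂ} (hF : Differentiable ℂ F) {a : ℂ} {ε R : ℝ}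
    (hε : 0 < ε) (h : ∀ z, R < ‖z‖ → ε ≤ ‖F z - a‖) :
    ∃ n : ℕ, (fun z => F z - a) =O[cobounded ℂ] (fun z => z ^ n) := by
  set φ : ℂ → ℂ := fun w => (F w⁻¹ - a)⁻¹ with hφ
  set r : ℝ := (|R| + 1)⁻¹ with hr
  have hr0 : 0 < r := by positivity
  have key : ∀ w ∈ Metric.ball (0 : ℂ) r \ {0}, ε ≤ ‖F w⁻¹ - a‖ := by
    rintro w ⟨hw, hw0⟩
    have hw0 : w ≠ 0 := hw0
    apply h
    rw [norm_inv]
    have h1 : ‖w‖ < (|R| + 1)⁻¹ := by simpa using hw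
    have h2 : |R| + 1 < ‖w‖⁻¹ := (lt_inv_comm₀ (by positivity) (by positivity)).2 h1
    linarith [le_abs_self R]
  have hne : ∀ w ∈ Metric.ball (0 : ℂ) r \ {0}, F w⁻¹ - a ≠ 0 := fun w hw =>
    norm_pos_iff.1 (hε.trans_le (key w hw))
  have hd : DifferentiableOn ℂ φ (Metric.ball (0 : ℂ) r \ {0}) := by
    intro w hw
    have hw0 : w ≠ 0 := hw.2
    exact (((hF _).comp w (differentiableAt_inv hw0)).sub_const a).inv (hne w hw)
      |>.differentiableWithinAt
  have hball : Metric.ball (0 : ℂ) r ∈ 𝓝 0 := Metric.ball_mem_nhds _ hr0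
  have hb : BddAbove (norm ∘ φ '' (Metric.ball (0 : ℂ) r \ {0})) := by
    refine ⟨ε⁻¹, ?_⟩
    rintro _ ⟨w, hw, rfl⟩
    simp only [hφ, Function.comp, norm_inv]
    exact inv_anti₀ hε (key w hw)
  have hψ := (Complex.differentiableOn_update_limUnder_of_bddAbove hball hd hb).analyticAt hball
  set ψ := Function.update φ 0 (limUnder (𝓝[≠] 0) φ)
  have hψφ : ∀ w ≠ 0, ψ w = φ w := fun w hw => Function.update_of_ne hw _ _
  have hball' : ∀ᶠ w in 𝓝[≠] (0 : ℂ), w ∈ Metric.ball (0 : ℂ) r \ {0} :=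
    sdiff_mem_nhdsWithin_compl hball _
  have hnz : ¬ ∀ᶠ w in 𝓝 0, ψ w = 0 := by
    intro h0
    obtain ⟨w, hw, hw0⟩ := (hball'.and (h0.filter_mono nhdsWithin_le_nhds)).exists
    rw [hψφ w hw.2] at hw0
    exact hne w hw (inv_eq_zero.1 hw0)
  obtain ⟨n, u, hu, hu0, hψu⟩ := hψ.exists_eventuallyEq_pow_smul_nonzero_iff.2 hnz
  refine ⟨n, .of_bound (‖u 0‖ / 2)⁻¹ ?_⟩
  have hun : ∀ᶠ w in 𝓝 0, ‖u 0‖ / 2 < ‖u w‖ :=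
    hu.continuousAt.norm.eventually_const_lt (half_lt_self (norm_pos_iff.2 hu0))
  have := (hball'.and ((hψu.and hun).filter_mono nhdsWithin_le_nhds))
  filter_upwards [tendsto_inv₀_cobounded'.eventually this] with z hz
  obtain ⟨hz, h1, h2⟩ := hz
  have hz0 : z ≠ 0 := fun h => hz.2 (by simp [h])
  rw [hψφ _ hz.2] at h1
  simp only [hφ, inv_inv, sub_zero, smul_eq_mul] at h1
  rw [inv_eq_iff_eq_inv, mul_inv, inv_pow, inv_inv] at h1
  rw [h1, norm_mul, norm_inv, mul_comm]
  gcongr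

/-- Cauchy estimates for entire functions of polynomial growth. -/
lemma iteratedDeriv_eq_zero_of_isBigO_pow {F : ℂ → ℂ} (hF : Differentiable ℂ F) {n m : ℕ}
    (h : F =O[cobounded ℂ] (fun z => z ^ n)) (hm : n < m) : iteratedDeriv m F 0 = 0 := by
  obtain ⟨C, hC⟩ := h.bound
  rw [← comap_norm_atTop, eventually_comap] at hC
  have hev : ∀ᶠ r : ℝ in atTop, ‖iteratedDeriv m F 0‖ ≤ m.factorial * C / r := by
    filter_upwards [hC, eventually_ge_atTop (1 : ℝ)] with r hr hr1
    have hr0 : 0 < r := by linarith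
    have hC0 : 0 ≤ C := by
      have := (norm_nonneg _).trans (hr (r : ℂ) (by simp [abs_of_pos hr0]))
      rw [norm_pow, Complex.norm_real, Real.norm_of_nonneg hr0.le] at this
      exact nonneg_of_mul_nonneg_left this (by positivity)
    have := Complex.norm_iteratedDeriv_le_of_forall_mem_sphere_norm_le (c := 0) (C := C * r ^ n)
      m hr0 hF.diffContOnCl (fun z hz => by
        have hz' : ‖z‖ = r := by simpa using hz
        simpa [hz'] using hr z hz')
    refine this.trans ?_
    rw [div_le_div_iff₀ (by positivity) hr0]
    have : r ^ n * r ≤ r ^ m := by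
      rw [← pow_succ]; exact pow_le_pow_right₀ hr1 hm
    calc m.factorial * (C * r ^ n) * r = m.factorial * C * (r ^ n * r) := by ring
      _ ≤ _ := by gcongr
  have hlim : Tendsto (fun r : ℝ => m.factorial * C / r) atTop (𝓝 0) :=
    tendsto_const_nhds.div_atTop tendsto_id
  exact norm_le_zero_iff.1 (ge_of_tendsto hlim hev)

/-- An entire function with finitely many nonzero Taylor coefficients is a polynomial. -/
lemma exists_polynomial_of_iteratedDeriv_eq_zero {f : ℂ → ℂ} (hf : Differentiable ℂ f) {n : ℕ}
    (h : ∀ m, n < m → iteratedDeriv m f 0 = 0) : ∃ p : ℂ[X], ∀ z, f z = p.eval z := by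
  refine ⟨∑ i ∈ Finset.range (n + 1), C ((i.factorial : ℂ)⁻¹ * iteratedDeriv i f 0) * X ^ i,
    fun z => ?_⟩
  rw [← Complex.taylorSeries_eq_of_entire' 0 z hf, tsum_eq_sum (s := Finset.range (n + 1))]
  · simp [eval_finsetSum]
  · intro m hm
    rw [h m (by simpa [Nat.lt_succ_iff] using hm)]
    simp

/-- The derivative of a transcendental entire function takes some value infinitely often. -/
lemma exists_infinite_preimage_deriv {f : ℂ → ℂ} (hf : Differentiable ℂ f)
    (htrans : ¬ ∃ p : ℂ[X], ∀ z, f z = p.eval z) : ∃ a, {z | deriv f z = a}.Infinite := by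
  have hF : Differentiable ℂ (deriv f) := hf.deriv
  have hgrowth : ∀ (a : ℂ) (n : ℕ), ¬ (fun z => deriv f z - a) =O[cobounded ℂ] (fun z => z ^ n) := by
    intro a n hO
    have hO' : deriv f =O[cobounded ℂ] (fun z => z ^ n) := by
      have hc : (fun _ : ℂ => a) =O[cobounded ℂ] (fun z => z ^ n) := by
        refine .of_bound ‖a‖ ?_
        filter_upwards [tendsto_norm_cobounded_atTop.eventually_ge_atTop 1] with z hz
        rw [norm_pow]
        exact le_mul_of_one_le_right (norm_nonneg _) (one_le_pow₀ hz)
      simpa using hO.add hc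
    refine htrans (exists_polynomial_of_iteratedDeriv_eq_zero hf (n := n + 1) fun m hm => ?_)
    obtain ⟨m, rfl⟩ : ∃ k, m = k + 1 := ⟨m - 1, by omega⟩
    rw [iteratedDeriv_succ']
    exact iteratedDeriv_eq_zero_of_isBigO_pow hF hO' (by omega)
  have hopen : IsOpenMap (deriv f) := by
    refine (AnalyticOnNhd.is_constant_or_isOpenMap fun z _ => hF.analyticAt z).resolve_left ?_
    rintro ⟨w, hw⟩
    exact hgrowth w 0 (by simpa only [hw, sub_self] using Asymptotics.isBigO_zero _ _)
  have hdense : Dense (⋂ n : ℕ, deriv f '' {z | (n : ℝ) < ‖z‖}) := by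
    refine dense_iInter_of_isOpen
      (fun n => hopen _ (isOpen_lt continuous_const continuous_norm)) fun n => ?_
    rw [Metric.dense_iff]
    intro a ε hε
    by_contra hcon
    obtain ⟨k, hk⟩ := exists_isBigO_pow_of_le_norm_sub hF (a := a) (R := n) hε fun z hz => by
      by_contra! hlt
      exact hcon ⟨deriv f z, by simpa [dist_eq_norm] using hlt, z, hz, rfl⟩
    exact hgrowth a k hk
  obtain ⟨a, ha⟩ := hdense.nonempty
  refine ⟨a, fun hfin => ?_⟩
  obtain ⟨M, hM⟩ := hfin.isBounded.exists_norm_le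
  obtain ⟨n, hn⟩ := exists_nat_gt M
  obtain ⟨z, hz, rfl⟩ := Set.mem_iInter.1 ha n
  have hz : (n : ℝ) < ‖z‖ := hz
  linarith [hM z rfl]

lemma differentiable_dslope {F : ℂ → ℂ} (hF : Differentiable ℂ F) (c : ℂ) :
    Differentiable ℂ (dslope F c) :=
  differentiableOn_univ.1 ((Complex.differentiableOn_dslope univ_mem).2 hF.differentiableOn)

/-- Entire functions square-integrable with respect to the weight `(1 + |F|²)⁻¹`. -/
def weightedBergman (F : ℂ → ℂ) (hF : Continuous F) : Submodule ℂ (ℂ → ℂ) where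
  carrier := {g | Differentiable ℂ g ∧
    Integrable (fun z : ℂ => ‖g z‖ ^ 2 / (1 + ‖F z‖ ^ 2))}
  zero_mem' := ⟨differentiable_const 0, by simp⟩
  add_mem' := by
    rintro g₁ g₂ ⟨hd₁, hi₁⟩ ⟨hd₂, hi₂⟩
    refine ⟨hd₁.add hd₂, ((hi₁.add hi₂).const_mul 2).mono' ?_ (.of_forall fun z => ?_)⟩
    · exact (((hd₁.add hd₂).continuous.norm.pow 2).div (continuous_const.add (hF.norm.pow 2))
        fun z => show 1 + ‖F z‖ ^ 2 ≠ 0 by positivity).aestronglyMeasurable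
    · rw [Real.norm_of_nonneg (by positivity)]
      simp only [Pi.add_apply]
      rw [← add_div, ← mul_div_assoc]
      gcongr
      have := norm_add_le (g₁ z) (g₂ z)
      nlinarith [sq_nonneg (‖g₁ z‖ - ‖g₂ z‖), norm_nonneg (g₁ z + g₂ z)]
  smul_mem' := by
    rintro c g ⟨hd, hi⟩
    refine ⟨hd.const_smul c, ?_⟩
    convert hi.const_mul (‖c‖ ^ 2) using 2 with z
    simp only [Pi.smul_apply, smul_eq_mul, norm_mul]
    ring

/-- If `(F - a) / ((z - s) (z - t))` is entire, it lies in the weighted Bergman space of `F`. -/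
lemma mem_weightedBergman_of_mul_eq {F g : ℂ → ℂ} (hF : Continuous F) (hg : Differentiable ℂ g)
    {a s t : ℂ} (h : ∀ z, (z - s) * ((z - t) * g z) = F z - a) :
    g ∈ weightedBergman F hF := by
  refine ⟨hg, ?_⟩
  have hcont : Continuous fun z : ℂ => ‖g z‖ ^ 2 / (1 + ‖F z‖ ^ 2) :=
    (hg.continuous.norm.pow 2).div (continuous_const.add (hF.norm.pow 2)) fun z => by positivity
  have hint : Integrable (fun z : ℂ => (1 + ‖z‖) ^ (-4 : ℝ)) :=
    integrable_one_add_norm (by rw [Complex.finrank_real_complex]; norm_num)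
  refine hcont.locallyIntegrable.integrable_of_isBigO_cocompact (g := fun z => (1 + ‖z‖) ^ (-4 : ℝ))
    ?_ (hint.integrableAtFilter _)
  rw [← Metric.cobounded_eq_cocompact]
  refine .of_bound (2 * (1 + ‖a‖ ^ 2) * 4 ^ 4) ?_
  have hlow : ∀ c : ℂ, ∀ᶠ z in cobounded ℂ, (1 + ‖z‖) / 4 ≤ ‖z - c‖ := fun c => by
    filter_upwards [tendsto_norm_cobounded_atTop.eventually_ge_atTop (1 + 2 * ‖c‖)] with z hz
    linarith [norm_sub_norm_le z c, norm_nonneg c]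
  filter_upwards [hlow s, hlow t] with z hs ht
  have hpos : 0 < 1 + ‖z‖ := by positivity
  have hE : ((1 + ‖z‖) / 4) * (((1 + ‖z‖) / 4) * ‖g z‖) ≤ ‖F z - a‖ := by
    rw [← h z, norm_mul, norm_mul]; gcongr
  have hsub : ‖F z - a‖ ^ 2 ≤ 2 * (1 + ‖a‖ ^ 2) * (1 + ‖F z‖ ^ 2) := by
    have h1 : ‖F z - a‖ ^ 2 ≤ (‖F z‖ + ‖a‖) ^ 2 := by gcongr; exact norm_sub_le _ _
    nlinarith [sq_nonneg (‖F z‖ - ‖a‖), sq_nonneg (‖F z‖ * ‖a‖)]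
  have hsq : (((1 + ‖z‖) / 4) * (((1 + ‖z‖) / 4) * ‖g z‖)) ^ 2 ≤ ‖F z - a‖ ^ 2 := by gcongr
  rw [Real.norm_of_nonneg (by positivity), Real.norm_of_nonneg (by positivity),
    Real.rpow_neg hpos.le, div_le_iff₀ (by positivity)]
  norm_cast
  rw [← div_eq_mul_inv, div_mul_eq_mul_div, le_div_iff₀ (by positivity)]
  push_cast
  linarith

/-- The functions `G / ((z - s) (z - t i))`, for distinct points `t i`, are linearly independent. -/
lemma linearIndependent_of_mul_eq {ι : Type*} {G : ℂ → ℂ} {t : ι → ℂ} (ht : Function.Injective t)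
    {g : ι → ℂ → ℂ} (hG : {z | G z ≠ 0}.Infinite) {s : ℂ}
    (h : ∀ i z, (z - s) * ((z - t i) * g i z) = G z) : LinearIndependent ℂ g := by
  classical
  rw [linearIndependent_iff']
  intro A c hc i hi
  set q : ℂ[X] := ∑ j ∈ A, C (c j) * ∏ k ∈ A.erase j, (X - C (t k)) with hq
  have hq0 : q = 0 := by
    refine eq_zero_of_infinite_isRoot q (hG.mono fun z hz => ?_)
    have hz : G z ≠ 0 := hz
    have hcz : ∑ j ∈ A, c j * g j z = 0 := by simpa using congrFun hc z
    refine (mul_eq_zero.1 (?_ : q.eval z * G z = 0)).resolve_right hz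
    calc q.eval z * G z = ∑ j ∈ A, (z - s) * (∏ k ∈ A, (z - t k)) * (c j * g j z) := by
          rw [hq, eval_finsetSum, Finset.sum_mul]
          refine Finset.sum_congr rfl fun j hj => ?_
          rw [← h j z, ← Finset.mul_prod_erase A _ hj]
          simp only [eval_mul, eval_C, eval_prod, eval_sub, eval_X]
          ring
      _ = 0 := by rw [← Finset.mul_sum, hcz, mul_zero]
  have hev : q.eval (t i) = c i * ∏ k ∈ A.erase i, (t i - t k) := by
    rw [hq, eval_finsetSum, Finset.sum_eq_single i]
    · simp [eval_prod]
    · intro j hj hji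
      simp only [eval_mul, eval_prod, eval_sub, eval_X, eval_C]
      rw [Finset.prod_eq_zero (Finset.mem_erase.2 ⟨hji.symm, hi⟩) (sub_self _), mul_zero]
    · exact fun hn => absurd hi hn
  rw [hq0, eval_zero, eq_comm, mul_eq_zero] at hev
  refine hev.resolve_right (Finset.prod_ne_zero_iff.2 fun k hk => sub_ne_zero.2 fun he => ?_)
  exact (Finset.mem_erase.1 hk).1 (ht he).symm



/-- The Remark following Theorem 1.12 of the paper (`P_{2,L²}(Γ(f)) = ∞`): if `f` is a
transcendental entire function on `ℂ` whose derivative omits a value `b`, then the set of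
entire functions `g` with `∫_ℂ |g|² (1+|f′|²)^{−1} dA < ∞` is a complex vector subspace of
`ℂ → ℂ` which is infinite-dimensional over `ℂ`. -/
theorem stmt_10 (f : ℂ → ℂ) (hf : Differentiable ℂ f)
    (htrans : ¬ ∃ p : Polynomial ℂ, ∀ z, f z = p.eval z)
    (b : ℂ) (hb : ∀ z, deriv f z ≠ b) :
    ∃ E : Submodule ℂ (ℂ → ℂ),
      (E : Set (ℂ → ℂ)) = {g | Differentiable ℂ g ∧
        Integrable (fun z : ℂ => ‖g z‖ ^ 2 / (1 + ‖deriv f z‖ ^ 2))} ∧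
      ¬ FiniteDimensional ℂ E := by
  have hF : Differentiable ℂ (deriv f) := hf.deriv
  refine ⟨weightedBergman (deriv f) hF.continuous, rfl, fun hfin => ?_⟩
  obtain ⟨a, ha⟩ := exists_infinite_preimage_deriv hf htrans
  obtain ⟨s, hs⟩ := ha.nonempty
  have hs : deriv f s = a := hs
  set S : Set ℂ := {z | deriv f z = a} \ {s} with hS
  have hSinf : S.Infinite := ha.sdiff (Set.finite_singleton s)
  set G : ℂ → ℂ := fun z => deriv f z - a with hG
  have hGd : Differentiable ℂ G := hF.sub_const a
  set g : S → ℂ → ℂ := fun t => dslope (dslope G s) t with hg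
  have hgd : ∀ t, Differentiable ℂ (g t) := fun t =>
    differentiable_dslope (differentiable_dslope hGd s) t
  have hGs : G s = 0 := sub_eq_zero.2 hs
  have hmul : ∀ (t : S) (z : ℂ), (z - s) * ((z - t) * g t z) = G z := by
    rintro ⟨t, ht, hts⟩ z
    have hts : t ≠ s := hts
    have hGt : G t = 0 := sub_eq_zero.2 ht
    have h0 : dslope G s t = 0 := by
      rw [dslope_of_ne _ hts, slope_def_field, hGs, hGt, sub_zero, zero_div]
    have h1 := sub_smul_dslope (dslope G s) t z
    have h2 := sub_smul_dslope G s z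
    rw [smul_eq_mul, h0, sub_zero] at h1
    rw [smul_eq_mul, hGs, sub_zero] at h2
    rw [hg, h1, h2]
  have hGinf : {z | G z ≠ 0}.Infinite := by
    obtain ⟨w, hw⟩ : ∃ w, G w ≠ 0 := by
      by_contra! hzero
      refine htrans (exists_polynomial_of_iteratedDeriv_eq_zero hf (n := 1) fun m hm => ?_)
      obtain ⟨m, rfl⟩ : ∃ k, m = k + 1 := ⟨m - 1, by omega⟩
      have : deriv f = fun _ => a := funext fun z => sub_eq_zero.1 (hzero z)
      rw [iteratedDeriv_succ', this, iteratedDeriv_const, if_neg (by omega)]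
    exact infinite_of_mem_nhds w (hGd.continuous.continuousAt.eventually_ne hw)
  have hli : LinearIndependent ℂ g :=
    linearIndependent_of_mul_eq Subtype.val_injective hGinf hmul
  have hli' : LinearIndependent ℂ fun t : S =>
      (⟨g t, mem_weightedBergman_of_mul_eq hF.continuous (hgd t) (hmul t)⟩ :
        weightedBergman (deriv f) hF.continuous) :=
    LinearIndependent.of_comp (Submodule.subtype _) hli
  have := hSinf.to_subtype
  exact (not_finite_iff_infinite.2 this) hli'.finite
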